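/- Suppose X and Y are metric spaces and the domain D of c is open in X × Y. Let G be a nonempty subset of D and let p, q ∈ G. If there is a ball chain in G from p to q, then p and q are strongly connected; consequently, if G is ball chain connected then G is strongly connected (any two points of G are strongly connected). -/

import Mathlib

open scoped BigOperators

namespace Paper

variable {X Y : Type*}

/-- The domain of the cost `c`, i.e. the set where `c` is finite. -/
def Dom (c : X × Y → EReal) : Set (X × Y) := {p | c p < ⊤}

/-- `z` is a path in `G` from `p` to `q` (with `N` steps). -/
def IsPath (c : X × Y → EReal) (G : Set (X × Y)) (p q : X × Y)
    (N : ℕ) (z : Fin (N + 1) → X × Y) : Prop :=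
  (∀ k, z k ∈ G) ∧ z 0 = p ∧ z (Fin.last N) = q ∧
    ∀ k : Fin N, c ((z k.succ).1, (z k.castSucc).2) < ⊤

/-- The inner variation `∑_{k=1}^N (c(x_k,y_k) − c(x_{k+1},y_k))` along a path; all the
terms involved are finite for a path in `G ⊆ Dom c`, so the real-valued sum is faithful. -/
noncomputable def pathSum (c : X × Y → EReal) {N : ℕ} (z : Fin (N + 1) → X × Y) : ℝ :=
  ∑ k : Fin N, ((c (z k.castSucc)).toReal - (c ((z k.succ).1, (z k.castSucc).2)).toReal)

/-- The maximal inner variation `F_G(p,q)`, with the convention `sSup ∅ = ⊥ = −∞`. -/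
noncomputable def innerVar (c : X × Y → EReal) (G : Set (X × Y)) (p q : X × Y) : EReal :=
  sSup {s : EReal | ∃ (N : ℕ) (z : Fin (N + 1) → X × Y),
    IsPath c G p q N z ∧ s = ((pathSum c z : ℝ) : EReal)}

/-- `G` is `c`-path bounded. -/
def PathBounded (c : X × Y → EReal) (G : Set (X × Y)) : Prop :=
  ∀ p ∈ G, ∀ q ∈ G, innerVar c G p q < ⊤

/-- `G` is `c`-cyclically monotone. -/
def CyclicallyMonotone (c : X × Y → EReal) (G : Set (X × Y)) : Prop :=
  ∀ p ∈ G, innerVar c G p p ≤ 0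

/-- `f` is a `c`-antiderivative of `G`:
`c(x,y) − c(u,y) ≤ f(x,y) − f(u,v)` in `[−∞,+∞]` for all `(x,y),(u,v) ∈ G`. -/
def IsAntideriv (c : X × Y → EReal) (G : Set (X × Y)) (f : X × Y → ℝ) : Prop :=
  ∀ p ∈ G, ∀ q ∈ G, c p - c (q.1, p.2) ≤ (f p : EReal) - (f q : EReal)

/-- `p` and `q` are strongly connected (mutually reachable by paths) in `G`. -/
def StronglyConn (c : X × Y → EReal) (G : Set (X × Y)) (p q : X × Y) : Prop :=
  (∃ N z, IsPath c G p q N z) ∧ (∃ N z, IsPath c G q p N z)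

/-- The ℓ²-product distance `√(d_X(x,u)² + d_Y(y,v)²)` on `X × Y`. -/
noncomputable def dist2 [PseudoMetricSpace X] [PseudoMetricSpace Y] (p q : X × Y) : ℝ :=
  Real.sqrt (dist p.1 q.1 ^ 2 + dist p.2 q.2 ^ 2)

/-- The open ball for the ℓ²-product distance. -/
def ball2 [PseudoMetricSpace X] [PseudoMetricSpace Y] (p : X × Y) (r : ℝ) : Set (X × Y) :=
  {q | dist2 p q < r}

/-- The maximal open ball centered at `p` contained in `Dom c`, i.e. `B_{ρ(p)}(p)` where
`ρ(p) = sup {r > 0 | B_r(p) ⊆ Dom c}`; note `dist2 p q < ρ(p)` iff there exists `r > 0`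
with `B_r(p) ⊆ Dom c` and `dist2 p q < r`. -/
def MaxBall [PseudoMetricSpace X] [PseudoMetricSpace Y]
    (c : X × Y → EReal) (p : X × Y) : Set (X × Y) :=
  {q | ∃ r : ℝ, 0 < r ∧ ball2 p r ⊆ Dom c ∧ dist2 p q < r}

/-- `z` is a ball chain in `G` from `p` to `q`. -/
def IsBallChain [PseudoMetricSpace X] [PseudoMetricSpace Y]
    (c : X × Y → EReal) (G : Set (X × Y)) (p q : X × Y)
    (N : ℕ) (z : Fin (N + 1) → X × Y) : Prop :=
  (∀ k, z k ∈ G) ∧ z 0 = p ∧ z (Fin.last N) = q ∧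
    ∀ k : Fin N, (MaxBall c (z k.castSucc) ∩ MaxBall c (z k.succ) ∩ G).Nonempty

theorem IsPath.snoc {c : X × Y → EReal} {G : Set (X × Y)} {p q r : X × Y} {N : ℕ}
    {z : Fin (N + 1) → X × Y} (hz : IsPath c G p q N z) (hr : r ∈ G) (hqr : c (r.1, q.2) < ⊤) :
    IsPath c G p r (N + 1) (Fin.snoc (α := fun _ => X × Y) z r) := by
  obtain ⟨hG, h0, hl, hstep⟩ := hz
  refine ⟨fun k => ?_, ?_, Fin.snoc_last _ _, fun k => ?_⟩
  · induction k using Fin.lastCases with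
    | last => simpa using hr
    | cast k => simpa using hG k
  · rw [← Fin.castSucc_zero, Fin.snoc_castSucc, h0]
  · induction k using Fin.lastCases with
    | last => simpa [hl] using hqr
    | cast k => simpa only [Fin.succ_castSucc, Fin.snoc_castSucc] using hstep k

/-- A single step of a path in `G`. -/
def PathStep (c : X × Y → EReal) (G : Set (X × Y)) (p q : X × Y) : Prop :=
  q ∈ G ∧ c (q.1, p.2) < ⊤

theorem exists_isPath_of_reflTransGen {c : X × Y → EReal} {G : Set (X × Y)} {p q : X × Y}
    (hp : p ∈ G) (h : Relation.ReflTransGen (PathStep c G) p q) :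
    ∃ N z, IsPath c G p q N z := by
  induction h with
  | refl => exact ⟨0, fun _ => p, fun _ => hp, rfl, rfl, fun k => k.elim0⟩
  | tail _ hqr ih =>
    obtain ⟨N, z, hz⟩ := ih
    exact ⟨N + 1, _, hz.snoc hqr.1 hqr.2⟩

theorem lt_top_of_mem_maxBall [PseudoMetricSpace X] [PseudoMetricSpace Y] {c : X × Y → EReal}
    {p w : X × Y} (hw : w ∈ MaxBall c p) : c (w.1, p.2) < ⊤ ∧ c (p.1, w.2) < ⊤ := by
  obtain ⟨r, -, hsub, hr⟩ := hw
  refine ⟨hsub (lt_of_le_of_lt (Real.sqrt_le_sqrt ?_) hr),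
    hsub (lt_of_le_of_lt (Real.sqrt_le_sqrt ?_) hr)⟩
  · simp
  · simp

theorem reflTransGen_of_maxBall_inter_nonempty [PseudoMetricSpace X] [PseudoMetricSpace Y]
    {c : X × Y → EReal} {G : Set (X × Y)} {p q : X × Y} (hq : q ∈ G)
    (h : (MaxBall c p ∩ MaxBall c q ∩ G).Nonempty) :
    Relation.ReflTransGen (PathStep c G) p q := by
  obtain ⟨w, ⟨hwp, hwq⟩, hwG⟩ := h
  exact .tail (.single ⟨hwG, (lt_top_of_mem_maxBall hwp).1⟩)
    ⟨hq, (lt_top_of_mem_maxBall hwq).2⟩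

theorem IsBallChain.stronglyConn [PseudoMetricSpace X] [PseudoMetricSpace Y]
    {c : X × Y → EReal} {G : Set (X × Y)} {p q : X × Y} {N : ℕ} {z : Fin (N + 1) → X × Y}
    (hz : IsBallChain c G p q N z) : StronglyConn c G p q := by
  obtain ⟨hG, rfl, rfl, hstep⟩ := hz
  have key : ∀ k, Relation.ReflTransGen (PathStep c G) (z 0) (z k) ∧
      Relation.ReflTransGen (PathStep c G) (z k) (z 0) := by
    intro k
    induction k using Fin.induction with
    | zero => exact ⟨.refl, .refl⟩
    | succ k ih =>
      refine ⟨ih.1.trans (reflTransGen_of_maxBall_inter_nonempty (hG _) (hstep k)),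
        (reflTransGen_of_maxBall_inter_nonempty (hG _) ?_).trans ih.2⟩
      rw [Set.inter_comm (MaxBall c _)]
      exact hstep k
  exact ⟨exists_isPath_of_reflTransGen (hG _) (key _).1,
    exists_isPath_of_reflTransGen (hG _) (key _).2⟩

/-- a ball chain from `p` to `q` makes `p` and `q` strongly connected;
consequently a ball chain connected set is strongly connected. -/
theorem stronglyConn_of_ballChain [MetricSpace X] [MetricSpace Y]
    (c : X × Y → EReal) (hbot : ∀ p, c p ≠ ⊥) (hD : IsOpen (Dom c))
    (G : Set (X × Y)) (hne : G.Nonempty) (hGD : G ⊆ Dom c) :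
    (∀ p ∈ G, ∀ q ∈ G,
        (∃ (N : ℕ) (z : Fin (N + 1) → X × Y), IsBallChain c G p q N z) →
        StronglyConn c G p q) ∧
      ((∀ p ∈ G, ∀ q ∈ G, ∃ (N : ℕ) (z : Fin (N + 1) → X × Y), IsBallChain c G p q N z) →
        ∀ p ∈ G, ∀ q ∈ G, StronglyConn c G p q) := by
  exact ⟨fun _ _ _ _ ⟨_, _, hz⟩ => hz.stronglyConn, fun h p hp q hq =>
    let ⟨_, _, hz⟩ := h p hp q hq
    hz.stronglyConn⟩

end Paper
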